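/- The only rational point on the genus 2 curve Y^2 = X^5 - 48 is the point at infinity; i.e., the equation y^2 = x^5 - 48 has no rational solutions. -/

import Mathlib

/-!
# The curve `Y ^ 2 = X ^ 5 - 48` has no affine rational points

A rational point gives coprime integers with `b ^ 2 + 48 e ^ 10 = a ^ 5`. Factoring in the ring of
Eisenstein integers yields `v (5 u ^ 4 - 30 u ^ 2 v ^ 2 + 9 v ^ 4) = 4 e ^ 5`; congruences
modulo `25` force `5 ∣ v`, and then one obtains a solution of `A ^ 2 - 5 B ^ 2 = t ^ 5` where `B` is
a fifth power up to primes dividing `30`. An infinite descent in `ℤ[(1 + √5) / 2]`, in the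
style of Dirichlet's proof of Fermat's Last Theorem for exponent `5`, excludes this.
-/

namespace QuadraticAlgebra

variable {a b : ℤ}

theorem exists_two_mul_sub_le (m : ℤ) {n : ℤ} (hn : n ≠ 0) : ∃ q : ℤ, |2 * (m - q * n)| ≤ |n| := by
  have h0 : 0 < |n| := abs_pos.2 hn
  have h1 := Int.mul_ediv_add_emod (2 * m + |n|) (2 * |n|)
  have h2 := Int.emod_nonneg (2 * m + |n|) (by positivity : (2 * |n|) ≠ 0)
  have h3 := Int.emod_lt_of_pos (2 * m + |n|) (by positivity : 0 < 2 * |n|)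
  set q := (2 * m + |n|) / (2 * |n|)
  rcases abs_choice n with h | h
  · refine ⟨q, abs_le.2 ⟨?_, ?_⟩⟩ <;> rw [h] at h1 h2 h3 ⊢ <;> linarith
  · refine ⟨-q, abs_le.2 ⟨?_, ?_⟩⟩ <;> rw [h] at h1 h2 h3 ⊢ <;> linarith

theorem noZeroDivisors_of_norm
    (h0 : ∀ z : QuadraticAlgebra ℤ a b, z.norm = 0 → z = 0) :
    NoZeroDivisors (QuadraticAlgebra ℤ a b) where
  eq_zero_or_eq_zero_of_mul_eq_zero {x y} h := by
    have : x.norm * y.norm = 0 := by rw [← map_mul, h, norm_zero]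
    exact (mul_eq_zero.1 this).imp (h0 x) (h0 y)

theorem isPrincipalIdealRing_of_norm
    (h0 : ∀ z : QuadraticAlgebra ℤ a b, z.norm = 0 → z = 0)
    (hlt : ∀ (n : ℤ) (z : QuadraticAlgebra ℤ a b), n ≠ 0 → |2 * z.re| ≤ |n| → |2 * z.im| ≤ |n| →
      |z.norm| < n ^ 2) :
    IsPrincipalIdealRing (QuadraticAlgebra ℤ a b) := by
  have hdiv (x y : QuadraticAlgebra ℤ a b) (hy : y ≠ 0) :
      ∃ q, (x - q * y).norm.natAbs < y.norm.natAbs := by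
    have hn : y.norm ≠ 0 := fun h => hy (h0 y h)
    obtain ⟨q, hq⟩ := exists_two_mul_sub_le (x * star y).re hn
    obtain ⟨r, hr⟩ := exists_two_mul_sub_le (x * star y).im hn
    refine ⟨⟨q, r⟩, ?_⟩
    have key : (x - ⟨q, r⟩ * y) * star y = x * star y - ⟨q * y.norm, r * y.norm⟩ := by
      ext <;> simp [norm_def] <;> ring
    have h := hlt y.norm ((x - ⟨q, r⟩ * y) * star y) hn (by rw [key]; exact hq)
      (by rw [key]; exact hr)
    rw [map_mul, norm_star, abs_mul, ← sq_abs y.norm, sq] at h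
    zify
    exact lt_of_mul_lt_mul_right h (abs_nonneg _)
  refine ⟨fun I => ?_⟩
  by_cases hI : ∃ y ∈ I, y ≠ 0
  · obtain ⟨y, ⟨hyI, hy0⟩, hmin⟩ := (measure fun z : QuadraticAlgebra ℤ a b =>
      z.norm.natAbs).wf.has_min {z | z ∈ I ∧ z ≠ 0} hI
    refine ⟨y, le_antisymm (fun x hx => ?_) ((Ideal.span_singleton_le_iff_mem I).2 hyI)⟩
    obtain ⟨q, hq⟩ := hdiv x y hy0
    refine Ideal.mem_span_singleton'.2 ⟨q, ?_⟩
    by_contra hne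
    exact hmin (x - q * y) ⟨I.sub_mem hx (I.mul_mem_left q hyI), fun h => hne (sub_eq_zero.1 h).symm⟩
      hq
  · push Not at hI
    exact ⟨0, by rw [Submodule.span_zero_singleton]; exact (Submodule.eq_bot_iff I).2 hI⟩

theorem associated_pow_of_norm_eq_pow [IsDomain (QuadraticAlgebra ℤ a b)]
    [IsPrincipalIdealRing (QuadraticAlgebra ℤ a b)] {z : QuadraticAlgebra ℤ a b} {t : ℤ} {n : ℕ}
    (h : z.norm = t ^ n) (hc : IsCoprime (trace z) t) :
    ∃ d : QuadraticAlgebra ℤ a b, Associated (d ^ n) z := by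
  have hmul : z * star z = (algebraMap ℤ _ t) ^ n := by
    rw [← algebraMap_norm_eq_mul_star, h, map_pow]
  refine exists_associated_pow_of_mul_eq_pow' ?_ hmul
  obtain ⟨r, s, hrs⟩ := (hc.pow_right (n := n)).map (algebraMap ℤ (QuadraticAlgebra ℤ a b))
  rw [algebraMap_trace_eq_add_star, map_pow, ← hmul] at hrs
  exact ⟨r + s * star z, r, by linear_combination hrs⟩

end QuadraticAlgebra

open QuadraticAlgebra

theorem isCoprime_of_eq_add_mul {m n x : ℤ} (k : ℤ) (h : IsCoprime m n) (hx : x = m + n * k) :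
    IsCoprime x n :=
  hx ▸ h.add_mul_left_left k

/-! ### The Eisenstein integers -/

theorem eisenstein_norm_eq_zero (z : QuadraticAlgebra ℤ (-1) (-1)) (h : z.norm = 0) : z = 0 := by
  rw [norm_def] at h
  have him : z.im = 0 := by
    have : z.im ^ 2 = 0 := by nlinarith [sq_nonneg (2 * z.re - z.im), sq_nonneg z.im]
    simpa using this
  have hre : z.re = 0 := by simpa [him] using h
  ext <;> simp [hre, him]

instance : NoZeroDivisors (QuadraticAlgebra ℤ (-1) (-1)) :=
  noZeroDivisors_of_norm eisenstein_norm_eq_zero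

instance : IsDomain (QuadraticAlgebra ℤ (-1) (-1)) := NoZeroDivisors.to_isDomain _

instance : IsPrincipalIdealRing (QuadraticAlgebra ℤ (-1) (-1)) :=
  isPrincipalIdealRing_of_norm eisenstein_norm_eq_zero fun n z hn hr hi => by
    have h0 : 0 < n ^ 2 := by positivity
    have h1 := sq_le_sq.2 hr
    have h2 := sq_le_sq.2 hi
    rw [norm_def, abs_lt]
    constructor <;> nlinarith [sq_nonneg (z.re - z.im), sq_nonneg (z.re + z.im)]

theorem eisenstein_unit_pow_six (u : (QuadraticAlgebra ℤ (-1) (-1))ˣ) : u ^ 6 = 1 := by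
  have hu := isUnit_iff_norm_isUnit.1 u.isUnit
  ext1
  rw [Units.val_pow_eq_pow_val, Units.val_one]
  obtain ⟨⟨x, y⟩, hz⟩ : ∃ z, z = (u : QuadraticAlgebra ℤ (-1) (-1)) := ⟨_, rfl⟩
  rw [← hz] at hu ⊢
  rw [Int.isUnit_iff, norm_def] at hu
  simp only at hu
  have hx : x ^ 2 ≤ 1 := by
    rcases hu with hu | hu <;> nlinarith [sq_nonneg (x - 2 * y), sq_nonneg x, sq_nonneg y]
  have hy : y ^ 2 ≤ 1 := by
    rcases hu with hu | hu <;> nlinarith [sq_nonneg (2 * x - y), sq_nonneg x, sq_nonneg y]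
  have hx1 : -1 ≤ x := by nlinarith
  have hx2 : x ≤ 1 := by nlinarith
  have hy1 : -1 ≤ y := by nlinarith
  have hy2 : y ≤ 1 := by nlinarith
  interval_cases x <;> interval_cases y <;> first | omega | (ext <;> simp [pow_succ])

/-- A fifth power represented primitively by `b ^ 2 + 3 d ^ 2`, with `b` odd and `d` even, comes from a
fifth power in `ℤ[√-3]`. -/
theorem exists_fifth_power_sqrt_neg_three {b d n : ℤ} (hb : Odd b) (hd : Even d)
    (hc : IsCoprime (2 * b) n) (h : b ^ 2 + 3 * d ^ 2 = n ^ 5) :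
    ∃ u v : ℤ, b = u * (u ^ 4 - 30 * u ^ 2 * v ^ 2 + 45 * v ^ 4) ∧
      d = v * (5 * u ^ 4 - 30 * u ^ 2 * v ^ 2 + 9 * v ^ 4) := by
  obtain ⟨α, ε, hε⟩ := associated_pow_of_norm_eq_pow (a := -1) (b := -1) (z := ⟨b + d, 2 * d⟩)
    (t := n) (n := 5) (by rw [← h, norm_def]; ring)
    (by convert hc using 1; simp only [trace_def]; ring)
  obtain ⟨⟨p, q⟩, hpq⟩ : ∃ β : QuadraticAlgebra ℤ (-1) (-1), β ^ 5 = ⟨b + d, 2 * d⟩ := by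
    refine ⟨α * ↑ε⁻¹, ?_⟩
    rw [← hε, mul_pow]
    congr 1
    rw [← Units.val_pow_eq_pow_val, Units.val_inj, inv_pow, inv_eq_iff_mul_eq_one, ← pow_succ]
    exact eisenstein_unit_pow_six ε
  have hre := congrArg QuadraticAlgebra.re hpq
  have him := congrArg QuadraticAlgebra.im hpq
  simp only [pow_succ, pow_zero, one_mul, re_mul, im_mul] at hre him
  have hq : Even q := by
    by_contra hq
    rw [Int.not_even_iff_odd] at hq
    have h1 := congrArg (Int.cast (R := ZMod 2)) hre
    have h2 := congrArg (Int.cast (R := ZMod 2)) him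
    rw [← ZMod.intCast_eq_one_iff_odd] at hb hq
    rw [← ZMod.intCast_eq_zero_iff_even] at hd
    push_cast at h1 h2
    rw [hb, hd, hq] at h1
    rw [hd, hq] at h2
    revert h1 h2
    generalize (p : ZMod 2) = p'
    revert p'
    decide
  obtain ⟨v, rfl⟩ := hq
  refine ⟨p - v, v, ?_, ?_⟩
  · linarith
  · linarith

/-! ### The ring `ℤ[(1 + √5) / 2]` -/

theorem golden_norm_eq_zero (z : QuadraticAlgebra ℤ 1 1) (h : z.norm = 0) : z = 0 := by
  rw [norm_def] at h
  have h5 : (2 * z.re + z.im) * (2 * z.re + z.im) = 5 * (z.im * z.im) := by linear_combination 4 * h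
  have hirr : ¬ IsSquare (5 : ℤ) := by
    rintro ⟨r, hr⟩
    have : r < 3 := by nlinarith
    have : -3 < r := by nlinarith
    interval_cases r <;> omega
  have him : z.im = 0 := by
    by_contra hne
    refine hirr ?_
    have hd : z.im ∣ 2 * z.re + z.im :=
      (Int.pow_dvd_pow_iff two_ne_zero).1 ⟨5, by linear_combination h5⟩
    obtain ⟨k, hk⟩ := hd
    refine ⟨k, mul_left_cancel₀ (mul_ne_zero hne hne) ?_⟩
    rw [hk] at h5
    linear_combination -h5
  have hre : z.re = 0 := by simpa [him] using h
  ext <;> simp [hre, him]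

instance : NoZeroDivisors (QuadraticAlgebra ℤ 1 1) := noZeroDivisors_of_norm golden_norm_eq_zero

instance : IsDomain (QuadraticAlgebra ℤ 1 1) := NoZeroDivisors.to_isDomain _

instance : IsPrincipalIdealRing (QuadraticAlgebra ℤ 1 1) :=
  isPrincipalIdealRing_of_norm golden_norm_eq_zero fun n z hn hr hi => by
    have h0 : 0 < n ^ 2 := by positivity
    have h1 := sq_le_sq.2 hr
    have h2 := sq_le_sq.2 hi
    rw [norm_def, abs_lt]
    constructor <;> nlinarith [sq_nonneg (z.re - z.im), sq_nonneg (z.re + z.im)]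

theorem golden_unit_eq_omega_pow_mul (n : ℕ) : ∀ x y : ℤ, x.natAbs + y.natAbs = n →
    x * x + x * y - y * y = 1 ∨ x * x + x * y - y * y = -1 →
    ∃ (j : ℕ) (η : QuadraticAlgebra ℤ 1 1), (⟨x, y⟩ : QuadraticAlgebra ℤ 1 1) = ω ^ j * η ^ 5 := by
  induction n using Nat.strong_induction_on with
  | _ n ih =>
    intro x y hn h
    have hinv : (ω : QuadraticAlgebra ℤ 1 1) * ⟨-1, 1⟩ = 1 := by ext <;> simp
    have hup (h' : y.natAbs + (x + y).natAbs < n) :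
        ∃ (j : ℕ) (η : QuadraticAlgebra ℤ 1 1), (⟨x, y⟩ : QuadraticAlgebra ℤ 1 1) = ω ^ j * η ^ 5 := by
      obtain ⟨j, η, hη⟩ := ih _ h' y (x + y) rfl
        (by rcases h with h | h
            · exact .inr (by linear_combination -h)
            · exact .inl (by linear_combination -h))
      refine ⟨j + 4, ⟨-1, 1⟩ * η, ?_⟩
      have : (⟨x, y⟩ : QuadraticAlgebra ℤ 1 1) = ⟨-1, 1⟩ * ⟨y, x + y⟩ := by ext <;> simp
      rw [this, hη]
      calc _ = (1 : QuadraticAlgebra ℤ 1 1) ^ 4 * ⟨-1, 1⟩ * (ω ^ j * η ^ 5) := by ring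
        _ = _ := by rw [← hinv]; ring
    have hdown (h' : (y - x).natAbs + x.natAbs < n) :
        ∃ (j : ℕ) (η : QuadraticAlgebra ℤ 1 1), (⟨x, y⟩ : QuadraticAlgebra ℤ 1 1) = ω ^ j * η ^ 5 := by
      obtain ⟨j, η, hη⟩ := ih _ h' (y - x) x rfl
        (by rcases h with h | h
            · exact .inr (by linear_combination -h)
            · exact .inl (by linear_combination -h))
      refine ⟨j + 1, η, ?_⟩
      have : (⟨x, y⟩ : QuadraticAlgebra ℤ 1 1) = ω * ⟨y - x, x⟩ := by ext <;> simp
      rw [this, hη]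
      ring
    have hneg : (-1 : QuadraticAlgebra ℤ 1 1) = (-1) ^ 5 := by ring
    rcases lt_trichotomy x 0 with hx | rfl | hx <;> rcases lt_trichotomy y 0 with hy | rfl | hy
    · have : 2 * y < x := by by_contra! hle; rcases h with h | h <;> nlinarith
      exact hdown (by omega)
    · have : x = -1 := by rcases h with h | h <;> nlinarith
      exact ⟨0, -1, by rw [← hneg, this]; ext <;> simp⟩
    · have : 2 * x < -y := by rcases h with h | h <;> nlinarith
      have : y < -2 * x := by by_contra! hle; rcases h with h | h <;> nlinarith
      exact hup (by omega)
    · have : y = -1 := by rcases h with h | h <;> nlinarith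
      exact ⟨1, -1, by rw [← hneg, this]; ext <;> simp⟩
    · simp at h
    · have : y = 1 := by rcases h with h | h <;> nlinarith
      exact ⟨1, 1, by rw [this]; ext <;> simp⟩
    · have : -y < 2 * x := by by_contra! hle; rcases h with h | h <;> nlinarith
      exact hup (by omega)
    · have : x = 1 := by rcases h with h | h <;> nlinarith
      exact ⟨0, 1, by rw [this]; ext <;> simp⟩
    · have : x < 2 * y := by by_contra! hle; rcases h with h | h <;> nlinarith
      exact hdown (by omega)

/-- A fifth power represented primitively by `A ^ 2 - 5 B ^ 2`, with `A` odd and `10 ∣ B`, comes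
from a fifth power in `ℤ[√5]`. -/
theorem exists_fifth_power_sqrt_five {A B t : ℤ} (hA : Odd A) (hB : Even B) (h5 : 5 ∣ B)
    (hAB : IsCoprime A B) (h : A ^ 2 - 5 * B ^ 2 = t ^ 5) :
    ∃ f g : ℤ, A = f * (f ^ 4 + 50 * f ^ 2 * g ^ 2 + 125 * g ^ 4) ∧
      B = 5 * g * (f ^ 4 + 10 * f ^ 2 * g ^ 2 + 5 * g ^ 4) := by
  have hA5 : IsCoprime A 5 := hAB.of_isCoprime_of_dvd_right h5
  have hA2 : IsCoprime (2 : ℤ) t := by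
    refine (IsCoprime.pow_right_iff (by norm_num : 0 < 5)).1 ?_
    rw [← h, Int.isCoprime_two_left]
    have := hA.pow (n := 2)
    have := (hB.pow_of_ne_zero two_ne_zero).mul_left 5
    grind
  have hAt : IsCoprime A t := by
    refine (IsCoprime.pow_right_iff (by norm_num : 0 < 5)).1 ?_
    rw [← h]
    exact (isCoprime_of_eq_add_mul A (hA5.mul_right (hAB.pow_right (n := 2))).neg_right.symm
      (by ring)).symm
  obtain ⟨α, ε, hε⟩ := associated_pow_of_norm_eq_pow (a := 1) (b := 1) (z := ⟨A - B, 2 * B⟩)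
    (t := t) (n := 5) (by rw [← h, norm_def]; ring)
    (by convert hA2.mul_left hAt using 1; simp only [trace_def]; ring)
  obtain ⟨j, β, hj, hβ⟩ : ∃ (j : ℕ) (β : QuadraticAlgebra ℤ 1 1), j < 5 ∧
      (⟨A - B, 2 * B⟩ : QuadraticAlgebra ℤ 1 1) = ω ^ j * β ^ 5 := by
    have hu := isUnit_iff_norm_isUnit.1 ε.isUnit
    rw [Int.isUnit_iff, norm_def] at hu
    obtain ⟨j, η, hη⟩ := golden_unit_eq_omega_pow_mul _ (ε : QuadraticAlgebra ℤ 1 1).re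
      (ε : QuadraticAlgebra ℤ 1 1).im rfl (by simpa using hu)
    refine ⟨j % 5, ω ^ (j / 5) * η * α, Nat.mod_lt _ (by norm_num), ?_⟩
    rw [← hε, show (ε : QuadraticAlgebra ℤ 1 1) = ω ^ j * η ^ 5 from hη]
    conv_lhs => rw [← Nat.mod_add_div j 5]
    ring
  obtain ⟨p, q⟩ := β
  have hre := congrArg QuadraticAlgebra.re hβ
  have him := congrArg QuadraticAlgebra.im hβ
  have hA0 : (A : ZMod 5) ≠ 0 := by
    rw [Ne, ZMod.intCast_zmod_eq_zero_iff_dvd]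
    intro hdvd
    have := hA5.isUnit_of_dvd' hdvd dvd_rfl
    norm_num [Int.isUnit_iff] at this
  have hj0 : j = 0 := by
    by_contra hj0
    have h1 := congrArg (Int.cast (R := ZMod 5)) hre
    have h2 := congrArg (Int.cast (R := ZMod 5)) him
    have hB0 : (B : ZMod 5) = 0 := (ZMod.intCast_zmod_eq_zero_iff_dvd _ _).2 h5
    revert h1 h2 hA0
    interval_cases j
    · exact absurd rfl hj0
    all_goals
      simp only [pow_succ, pow_zero, one_mul, re_mul, im_mul, omega_re, omega_im]
      push_cast
      rw [hB0]
      generalize (p : ZMod 5) = p'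
      generalize (q : ZMod 5) = q'
      generalize (A : ZMod 5) = A'
      revert p' q' A'
      decide
  subst hj0
  simp only [pow_succ, pow_zero, one_mul, re_mul, im_mul] at hre him
  have hq : Even q := by
    by_contra hq
    rw [Int.not_even_iff_odd] at hq
    have h1 := congrArg (Int.cast (R := ZMod 2)) hre
    have h2 := congrArg (Int.cast (R := ZMod 2)) him
    rw [← ZMod.intCast_eq_one_iff_odd] at hA hq
    rw [← ZMod.intCast_eq_zero_iff_even] at hB
    push_cast at h1 h2
    rw [hA, hB, hq] at h1
    rw [hB, hq] at h2
    revert h1 h2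
    generalize (p : ZMod 2) = p'
    revert p'
    decide
  obtain ⟨g, rfl⟩ := hq
  exact ⟨p + g, g, by linarith, by linarith⟩

/-! ### The descent -/

theorem isCoprime_of_not_dvd {p n : ℤ} (hp : Prime p) (h : ¬ p ∣ n) : IsCoprime n p :=
  (hp.irreducible.coprime_iff_not_dvd.2 h).symm

theorem not_five_dvd_of_isCoprime {A B : ℤ} (h : IsCoprime A B) (h5 : 5 ∣ B) :
    ¬ 5 ∣ A := fun hA => by
  have := h.isUnit_of_dvd' hA h5
  norm_num [Int.isUnit_iff] at this

theorem not_sq_sub_five_sq_eq_fifth_power (n : ℕ) : ∀ (A B t c : ℤ) (k : ℕ), B.natAbs = n →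
    B ≠ 0 → Odd A → Even B → 25 ∣ B → IsCoprime A B → A ^ 2 - 5 * B ^ 2 = t ^ 5 → c ∣ 30 ^ k →
    (∃ h, c * B = h ^ 5) → False := by
  induction n using Nat.strong_induction_on with
  | _ n ih =>
    rintro A B t c k hn hB0 hA hB h25 hAB ht hc ⟨h, hh⟩
    have h5B : 5 ∣ B := dvd_trans (by norm_num) h25
    obtain ⟨f, g, hf, hg⟩ := exists_fifth_power_sqrt_five hA hB h5B hAB ht
    set Q := f ^ 4 + 10 * f ^ 2 * g ^ 2 + 5 * g ^ 4 with hQ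
    have hfg : IsCoprime f g := (hAB.of_isCoprime_of_dvd_left ⟨_, hf⟩).of_isCoprime_of_dvd_right
      ⟨5 * Q, by rw [hg]; ring⟩
    have hfodd : Odd f := by rw [hf] at hA; exact (Int.odd_mul.1 hA).1
    have hgeven : Even g := by
      by_contra hgo
      rw [Int.not_even_iff_odd] at hgo
      rw [← ZMod.intCast_eq_one_iff_odd] at hA hfodd hgo
      rw [hf] at hA
      push_cast at hA
      rw [hfodd, hgo] at hA
      revert hA
      decide
    have hf5 : ¬ 5 ∣ f := fun hd => not_five_dvd_of_isCoprime hAB h5B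
      (hf ▸ hd.mul_right _)
    have hQ5 : ¬ 5 ∣ Q := fun hd => hf5 <| (by norm_num : Prime (5 : ℤ)).dvd_of_dvd_pow (n := 4) <| by
      rw [show f ^ 4 = Q - 5 * (2 * f ^ 2 * g ^ 2 + g ^ 4) by rw [hQ]; ring]
      exact hd.sub (dvd_mul_right _ _)
    have hg5 : 5 ∣ g := by
      have : (5 : ℤ) ∣ g * Q := by
        obtain ⟨m, hm⟩ := h25
        exact ⟨m, by linarith⟩
      exact ((by norm_num : Prime (5 : ℤ)).dvd_or_dvd this).resolve_right hQ5
    have hg0 : g ≠ 0 := by rintro rfl; simp at hg; exact hB0 hg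
    have hQ3 : ¬ 3 ∣ Q := by
      intro hd
      have hz : ∀ x y : ZMod 3, x ^ 4 + 10 * x ^ 2 * y ^ 2 + 5 * y ^ 4 = 0 → x = 0 ∧ y = 0 := by
        decide
      have := hz f g (by
        have := (ZMod.intCast_zmod_eq_zero_iff_dvd Q 3).2 (by exact_mod_cast hd)
        rw [hQ] at this
        push_cast at this
        exact this)
      have := hfg.isUnit_of_dvd' ((ZMod.intCast_zmod_eq_zero_iff_dvd f 3).1 this.1)
        ((ZMod.intCast_zmod_eq_zero_iff_dvd g 3).1 this.2)
      norm_num [Int.isUnit_iff] at this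
    have hQ2 : ¬ 2 ∣ Q := by
      have := hfodd.pow (n := 4)
      have : Even (10 * f ^ 2 * g ^ 2 + 5 * g ^ 4) := by simp [hgeven, parity_simps]
      rw [← even_iff_two_dvd, hQ]
      grind
    have hQ30 : IsCoprime Q 30 := by
      have := ((isCoprime_of_not_dvd (by norm_num : Prime (2 : ℤ)) hQ2).mul_right
        (isCoprime_of_not_dvd Int.prime_three hQ3)).mul_right
        (isCoprime_of_not_dvd (by norm_num : Prime (5 : ℤ)) hQ5)
      norm_num at this
      exact this
    have hQg : IsCoprime Q g :=
      isCoprime_of_eq_add_mul (10 * f ^ 2 * g + 5 * g ^ 3) (hfg.pow_left (m := 4))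
        (by rw [hQ]; ring)
    have hQc : IsCoprime Q c := (hQ30.pow_right (n := k)).of_isCoprime_of_dvd_right hc
    obtain ⟨⟨H, hH⟩, T, hT⟩ := Int.eq_pow_of_mul_eq_pow_odd (a := 5 * c * g) (b := Q) (c := h)
      (((isCoprime_of_not_dvd (by norm_num : Prime (5 : ℤ)) hQ5).mul_right hQc).mul_right hQg).symm
      (k := 5) (by decide) (by rw [← hh, hg]; ring)
    refine ih (2 * g ^ 2).natAbs ?_ (f ^ 2 + 5 * g ^ 2) (2 * g ^ 2) T (400 * c ^ 2) (4 + 2 * k) rfl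
      (by positivity) ?_ (even_two_mul _) ?_ ?_ ?_ ?_ ⟨2 * H ^ 2, ?_⟩
    · rw [← hn]
      zify
      have h1 : 25 ≤ g ^ 2 := by
        obtain ⟨m, rfl⟩ := hg5
        have : 0 < m ^ 2 := by have : m ≠ 0 := by rintro rfl; simp at hg0
                               positivity
        nlinarith
      have h2 : g ^ 2 ≤ Q := by nlinarith [sq_nonneg f, sq_nonneg (f * g), sq_nonneg (f ^ 2)]
      have h3 : 1 ≤ |g| := Int.one_le_abs hg0
      rw [hg, abs_of_nonneg (by positivity : 0 ≤ 2 * g ^ 2), abs_mul, abs_mul, abs_of_pos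
        (by linarith : 0 < Q), abs_of_pos (by norm_num : (0 : ℤ) < 5)]
      nlinarith
    · have := hfodd.pow (n := 2)
      have : Even (5 * g ^ 2) := by simp [hgeven, parity_simps]
      exact Odd.add_even ‹_› this
    · exact (dvd_trans (by norm_num) (pow_dvd_pow_of_dvd hg5 2)).mul_left _
    · refine IsCoprime.mul_right ?_ ?_
      · rw [Int.isCoprime_two_right]
        exact (hfodd.pow (n := 2)).add_even ((hgeven.pow_of_ne_zero two_ne_zero).mul_left 5)
      · exact ((hfg.pow_left (m := 2)).pow_right (n := 2)).add_mul_right_left 5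
    · rw [← hT, hQ]
      ring
    · rw [pow_add, pow_mul']
      exact mul_dvd_mul (by norm_num) (pow_dvd_pow_of_dvd hc 2)
    · rw [mul_pow, ← pow_mul, mul_comm 2 5, pow_mul, ← hH]
      ring

/-! ### The quintic form and the curve -/

theorem eq_zero_of_quintic_form_eq {u v e : ℤ} (hu : Odd u) (hv : Even v) (hu3 : ¬ 3 ∣ u)
    (huv : IsCoprime u v) (h : v * (5 * u ^ 4 - 30 * u ^ 2 * v ^ 2 + 9 * v ^ 4) = 4 * e ^ 5) :
    v = 0 := by
  by_contra hv0
  have p5 : Prime (5 : ℤ) := by norm_num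
  by_cases hv5 : 5 ∣ v
  · obtain ⟨w, rfl⟩ := hv5
    have he5 : 5 ∣ e := p5.dvd_of_dvd_pow (n := 5) <| by
      have : (5 : ℤ) ∣ 4 * e ^ 5 := h ▸ (dvd_mul_right 5 w).mul_right _
      exact (p5.dvd_or_dvd this).resolve_left (by norm_num)
    obtain ⟨d, rfl⟩ := he5
    have hw0 : w ≠ 0 := by rintro rfl; simp at hv0
    have huw : IsCoprime u w := huv.of_mul_right_right
    have hu5 : IsCoprime u 5 := huv.of_mul_right_left
    have hu2 : IsCoprime u 2 := Int.isCoprime_two_right.2 hu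
    have hweven : Even w := by
      rcases Int.even_mul.1 hv with h | h
      · exact absurd h (by decide)
      · exact h
    set Q := u ^ 4 - 150 * u ^ 2 * w ^ 2 + 1125 * w ^ 4 with hQ
    have hQw : IsCoprime Q w :=
      isCoprime_of_eq_add_mul (-150 * u ^ 2 * w + 1125 * w ^ 3) (huw.pow_left (m := 4))
        (by rw [hQ]; ring)
    have hQ5 : IsCoprime Q 5 :=
      isCoprime_of_eq_add_mul (-30 * u ^ 2 * w ^ 2 + 225 * w ^ 4) (hu5.pow_left (m := 4))
        (by rw [hQ]; ring)
    have hQ2 : IsCoprime Q 2 := by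
      rw [Int.isCoprime_two_right, hQ]
      have := hu.pow (n := 4)
      have : Even (-150 * u ^ 2 * w ^ 2 + 1125 * w ^ 4) := by simp [hweven, parity_simps]
      grind
    have hQ200 : IsCoprime Q 200 := by
      have := (hQ2.pow_right (n := 3)).mul_right (hQ5.pow_right (n := 2))
      norm_num at this
      exact this
    obtain ⟨⟨x, hx⟩, t, ht⟩ := Int.eq_pow_of_mul_eq_pow_odd (a := 200 * w) (b := Q) (c := 10 * d)
      (hQ200.mul_right hQw).symm (k := 5) (by decide) (by linear_combination 8 * h)
    have hw5 : 5 ∣ w := by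
      have hx5 : 5 ∣ x := p5.dvd_of_dvd_pow (n := 5) ⟨40 * w, by linarith⟩
      obtain ⟨y, rfl⟩ := hx5
      ring_nf at hx
      omega
    have hu30 : IsCoprime u 30 := by
      have := (hu2.mul_right (isCoprime_of_not_dvd Int.prime_three hu3)).mul_right hu5
      norm_num at this
      exact this
    refine not_sq_sub_five_sq_eq_fifth_power _ (u ^ 2 - 75 * w ^ 2) (30 * w ^ 2) t
      (30 ^ 4 * 200 ^ 2) 10 rfl (by positivity) ?_ ?_ ?_ ?_ ?_ (by norm_num) ⟨30 * x ^ 2, ?_⟩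
    · exact (hu.pow (n := 2)).sub_even ((hweven.pow_of_ne_zero two_ne_zero).mul_left 75)
    · exact Even.mul_right (by decide) _
    · exact (dvd_trans (by norm_num) (pow_dvd_pow_of_dvd hw5 2)).mul_left _
    · refine IsCoprime.mul_right ?_ ?_
      · have h2 : IsCoprime (u ^ 2 - 75 * w ^ 2) 2 := by
          rw [Int.isCoprime_two_right]
          exact (hu.pow (n := 2)).sub_even ((hweven.pow_of_ne_zero two_ne_zero).mul_left 75)
        have h15 : IsCoprime (u ^ 2 - 75 * w ^ 2) 15 :=
          isCoprime_of_eq_add_mul (-5 * w ^ 2)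
            ((hu30.of_isCoprime_of_dvd_right (by norm_num : (15 : ℤ) ∣ 30)).pow_left (m := 2))
            (by ring)
        have := h2.mul_right h15
        norm_num at this
        exact this
      · exact isCoprime_of_eq_add_mul (-75) ((huw.pow_left (m := 2)).pow_right (n := 2))
          (by ring)
    · rw [← ht, hQ]
      ring
    · rw [mul_pow, ← pow_mul, mul_comm 2 5, pow_mul, ← hx]
      ring
  · set Q := 5 * u ^ 4 - 30 * u ^ 2 * v ^ 2 + 9 * v ^ 4 with hQ
    have hQ2 : IsCoprime Q 2 := by
      rw [Int.isCoprime_two_right, hQ]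
      have : Odd (5 * u ^ 4) := Odd.mul (by decide) hu.pow
      have : Even (-30 * u ^ 2 * v ^ 2 + 9 * v ^ 4) := by simp [hv, parity_simps]
      grind
    have hQv : IsCoprime Q v :=
      isCoprime_of_eq_add_mul (-30 * u ^ 2 * v + 9 * v ^ 3)
        ((isCoprime_of_not_dvd p5 hv5).symm.mul_left
        (huv.pow_left (m := 4)))
        (by rw [hQ]; ring)
    obtain ⟨⟨x, hx⟩, t, ht⟩ := Int.eq_pow_of_mul_eq_pow_odd (a := 8 * v) (b := Q) (c := 2 * e)
      (((hQ2.pow_right (n := 3)).mul_right hQv).symm) (k := 5) (by decide)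
      (by linear_combination 8 * h)
    have hpow : ∀ z : ZMod 25, z ^ 5 = 0 ∨ z ^ 5 = 1 ∨ z ^ 5 = -1 ∨ z ^ 5 = 7 ∨ z ^ 5 = -7 := by
      decide
    have hv25 : (v : ZMod 25) = 22 * (x : ZMod 25) ^ 5 := by
      have := congrArg (Int.cast (R := ZMod 25)) hx
      push_cast at this
      rw [← this, ← mul_assoc, show (22 * 8 : ZMod 25) = 1 by decide, one_mul]
    have hQ25 := congrArg (Int.cast (R := ZMod 25)) (hQ.symm.trans ht)
    push_cast at hQ25
    have hx0 : (x : ZMod 25) ^ 5 ≠ 0 := by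
      intro h0
      rw [h0, mul_zero, ZMod.intCast_zmod_eq_zero_iff_dvd] at hv25
      exact hv5 (dvd_trans (by norm_num) hv25)
    rw [hv25] at hQ25
    revert hQ25
    generalize (u : ZMod 25) = u'
    rcases hpow x with h | h | h | h | h
    · exact absurd h hx0
    all_goals
      rw [h]
      rcases hpow t with h' | h' | h' | h' | h' <;> rw [h'] <;> revert u' <;> decide

theorem sq_emod_eight_of_odd {n : ℤ} (hn : Odd n) : n ^ 2 % 8 = 1 := by
  have : n % 8 = 1 ∨ n % 8 = 3 ∨ n % 8 = 5 ∨ n % 8 = 7 := by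
    have := Int.odd_iff.1 hn
    omega
  rcases this with h | h | h | h <;> norm_num [sq, Int.mul_emod, h]

theorem odd_of_sq_add_eq_fifth_power {a b e : ℤ} (hae : IsCoprime a e)
    (h : b ^ 2 + 48 * e ^ 10 = a ^ 5) : Odd a := by
  by_contra ha
  rw [Int.not_odd_iff_even] at ha
  have he : Odd e := by
    rw [← Int.isCoprime_two_left]
    exact hae.of_isCoprime_of_dvd_left ha.two_dvd
  obtain ⟨c, rfl⟩ := ha.two_dvd
  obtain ⟨d, rfl⟩ : 2 ∣ b := Int.prime_two.dvd_of_dvd_pow (n := 2)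
    ⟨16 * c ^ 5 - 24 * e ^ 10, by linarith⟩
  obtain ⟨d, rfl⟩ : 2 ∣ d := Int.prime_two.dvd_of_dvd_pow (n := 2)
    ⟨4 * c ^ 5 - 6 * e ^ 10, by linarith⟩
  have h' : d ^ 2 + 3 * (e ^ 5) ^ 2 = 2 * c ^ 5 := by linarith
  have hd : Odd d := by
    rw [← ZMod.intCast_eq_one_iff_odd] at he ⊢
    have h2 := congrArg (Int.cast (R := ZMod 2)) h'
    push_cast at h2
    rw [he] at h2
    revert h2
    generalize (d : ZMod 2) = d'
    generalize (c : ZMod 2) = c'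
    revert d' c'
    decide
  have h8d : d ^ 2 % 8 = 1 := sq_emod_eight_of_odd hd
  have h8e : (e ^ 5) ^ 2 % 8 = 1 := sq_emod_eight_of_odd he.pow
  have hc4 : c ^ 5 % 4 = 2 := by omega
  have hc2 : 2 ∣ c := Int.prime_two.dvd_of_dvd_pow (n := 5) (by omega)
  have := pow_dvd_pow_of_dvd hc2 5
  omega

theorem sq_add_mul_pow_ne_fifth_power {a b e : ℤ} (hae : IsCoprime a e) (he : e ≠ 0) :
    b ^ 2 + 48 * e ^ 10 ≠ a ^ 5 := by
  intro h
  have ha := odd_of_sq_add_eq_fifth_power hae h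
  have hb : Odd b := by
    have h1 : Odd (b ^ 2) := by
      have := ha.pow (n := 5)
      have : Even (48 * e ^ 10) := Even.mul_right (by decide) _
      rw [show b ^ 2 = a ^ 5 - 48 * e ^ 10 by linarith]
      exact Odd.sub_even ‹_› this
    exact (Int.odd_pow' two_ne_zero).1 h1
  have hb3 : ¬ 3 ∣ b := by
    rintro ⟨c, rfl⟩
    have ha3 : 3 ∣ a := Int.prime_three.dvd_of_dvd_pow (n := 5) ⟨3 * c ^ 2 + 16 * e ^ 10, by linarith⟩
    have he3 : 3 ∣ e := by
      obtain ⟨d, rfl⟩ := ha3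
      refine Int.prime_three.dvd_of_dvd_pow (n := 10) ?_
      have : (3 : ℤ) ∣ 16 * e ^ 10 := ⟨27 * d ^ 5 - c ^ 2, by linarith⟩
      omega
    have := hae.isUnit_of_dvd' ha3 he3
    norm_num [Int.isUnit_iff] at this
  have ha3 : ¬ 3 ∣ a := by
    rintro ⟨c, rfl⟩
    exact hb3 (Int.prime_three.dvd_of_dvd_pow (n := 2) ⟨81 * c ^ 5 - 16 * e ^ 10, by linarith⟩)
  have ha2 : IsCoprime a 2 := Int.isCoprime_two_right.2 ha
  have ha48 : IsCoprime a 48 := by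
    have := (ha2.pow_right (n := 4)).mul_right (isCoprime_of_not_dvd Int.prime_three ha3)
    norm_num at this
    exact this
  have hab : IsCoprime a b := by
    refine (IsCoprime.pow_right_iff (by norm_num : 0 < 2)).1 ?_
    exact (isCoprime_of_eq_add_mul (a ^ 4) (ha48.mul_right (hae.pow_right (n := 10))).neg_right.symm
      (by linarith)).symm
  have hbe : IsCoprime b e := by
    refine (IsCoprime.pow_left_iff (by norm_num : 0 < 2)).1 ?_
    exact isCoprime_of_eq_add_mul (-48 * e ^ 9) (hae.pow_left (m := 5))
      (by linarith)
  obtain ⟨u, v, hu, hv⟩ := exists_fifth_power_sqrt_neg_three (b := b) (d := 4 * e ^ 5) (n := a) hb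
    (Even.mul_right (by decide) _) (ha2.mul_right hab).symm (by linarith)
  have hb4e : IsCoprime b (4 * e ^ 5) := by
    have := ((Int.isCoprime_two_right.2 hb).pow_right (n := 2)).mul_right (hbe.pow_right (n := 5))
    norm_num at this
    exact this
  have huodd : Odd u := by rw [hu] at hb; exact (Int.odd_mul.1 hb).1
  have hveven : Even v := by
    by_contra hvo
    rw [Int.not_even_iff_odd] at hvo
    rw [← ZMod.intCast_eq_one_iff_odd] at hb huodd hvo
    rw [hu] at hb
    push_cast at hb
    rw [huodd, hvo] at hb
    revert hb
    decide
  have hv0 := eq_zero_of_quintic_form_eq huodd hveven (fun hd => hb3 (hu ▸ hd.mul_right _))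
    ((hb4e.of_isCoprime_of_dvd_left ⟨_, hu⟩).of_isCoprime_of_dvd_right ⟨_, hv⟩) hv.symm
  rw [hv0, zero_mul] at hv
  have : e ^ 5 = 0 := by linarith
  exact he (by simpa using this)

theorem no_rational_points_x5_minus_48 : ¬ ∃ x y : ℚ, y ^ 2 = x ^ 5 - 48 := by
  rintro ⟨x, y, h⟩
  have hx0 : (x.den : ℤ) ≠ 0 := by exact_mod_cast x.den_ne_zero
  have hxc : IsCoprime x.num (x.den : ℤ) := by
    rw [Int.isCoprime_iff_nat_coprime]; simpa using x.reduced
  have hyc : IsCoprime y.num (y.den : ℤ) := by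
    rw [Int.isCoprime_iff_nat_coprime]; simpa using y.reduced
  have hint : y.num ^ 2 * (x.den : ℤ) ^ 5 = (y.den : ℤ) ^ 2 * (x.num ^ 5 - 48 * (x.den : ℤ) ^ 5) := by
    rw [← Rat.num_div_den x, ← Rat.num_div_den y] at h
    have hxq : (x.den : ℚ) ≠ 0 := by exact_mod_cast x.den_ne_zero
    have hyq : (y.den : ℚ) ≠ 0 := by exact_mod_cast y.den_ne_zero
    field_simp at h
    have h' : (y.num : ℚ) ^ 2 * (x.den : ℚ) ^ 5
        = (y.den : ℚ) ^ 2 * ((x.num : ℚ) ^ 5 - 48 * (x.den : ℚ) ^ 5) := by linarith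
    exact_mod_cast h'
  have hcop : IsCoprime ((x.den : ℤ) ^ 5) (x.num ^ 5 - 48 * (x.den : ℤ) ^ 5) :=
    (isCoprime_of_eq_add_mul (-48) (hxc.pow (m := 5) (n := 5))
      (by ring)).symm
  have hden : x.den ^ 5 = y.den ^ 2 := by
    have h1 := hcop.dvd_of_dvd_mul_right (Dvd.intro_left _ hint)
    have h2 := (hyc.symm.pow (m := 2) (n := 2)).dvd_of_dvd_mul_left (Dvd.intro _ hint.symm)
    exact Nat.dvd_antisymm (by exact_mod_cast h1) (by exact_mod_cast h2)
  obtain ⟨e, he⟩ : x.den ^ 2 ∣ y.den :=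
    (Nat.pow_dvd_pow_iff two_ne_zero).1 ⟨x.den, by rw [← hden]; ring⟩
  have hxe : x.den = e ^ 2 := by
    refine mul_left_cancel₀ (pow_ne_zero 4 x.den_ne_zero) ?_
    rw [he] at hden
    linarith
  have hxe' : (x.den : ℤ) = (e : ℤ) ^ 2 := by exact_mod_cast hxe
  have hden' : (x.den : ℤ) ^ 5 = (y.den : ℤ) ^ 2 := by exact_mod_cast hden
  have he0 : (e : ℤ) ≠ 0 := by
    intro h0
    exact hx0 (by simp [hxe', h0])
  have hxce : IsCoprime x.num (e : ℤ) := by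
    rw [hxe'] at hxc
    exact (IsCoprime.pow_right_iff (by norm_num : 0 < 2)).1 hxc
  refine sq_add_mul_pow_ne_fifth_power (b := y.num) hxce he0 ?_
  rw [← hden', mul_comm] at hint
  have := mul_left_cancel₀ (pow_ne_zero 5 hx0) hint
  rw [this, hxe']
  ring
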